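/- Let H = N⋊T be the smash product of cocommutative Hopf algebras N and T over a field k, acting trivially on the commutative k-algebra A. Let Z'²(H,A) be the group of Sweedler 2-cocycles f on H with f(n⊗t) = ε(n)ε(t)1_A and f(t⊗t') = ε(t)ε(t')1_A for all n ∈ N and t,t' ∈ T, and let B'²(H,A) = B²(H,A) ∩ Z'²(H,A). Then the natural map from H'²(H,A) = Z'²(H,A)/B'²(H,A) to H²(H,A) is injective with image H̃²(H,A), giving an isomorphism H'²(H,A) ≅ H̃²(H,A). -/

import Mathlib

open TensorProduct

namespace SmashPaper

variable (k : Type) [Field k]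

section Conv

variable {k : Type} [Field k] {C A : Type} [AddCommGroup C] [Module k C] [Coalgebra k C]
  [CommRing A] [Algebra k A]

/-- Convolution product on linear maps from a coalgebra to an algebra. -/
noncomputable def conv (f g : C →ₗ[k] A) : C →ₗ[k] A :=
  LinearMap.mul' k A ∘ₗ TensorProduct.map f g ∘ₗ Coalgebra.comul

/-- Convolution unit. -/
noncomputable def convOne (C A : Type) [AddCommGroup C] [Module k C] [Coalgebra k C]
    [CommRing A] [Algebra k A] : C →ₗ[k] A :=
  Algebra.linearMap k A ∘ₗ Coalgebra.counit

def IsConvInv (f g : C →ₗ[k] A) : Prop :=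
  conv f g = convOne C A ∧ conv g f = convOne C A

def IsConvInvertible (f : C →ₗ[k] A) : Prop := ∃ g, IsConvInv f g

end Conv

/-- Cocommutativity of a coalgebra. -/
def IsCocomm (C : Type) [AddCommGroup C] [Module k C] [Coalgebra k C] : Prop :=
  (TensorProduct.comm k C C).toLinearMap ∘ₗ Coalgebra.comul
    = (Coalgebra.comul : C →ₗ[k] C ⊗[k] C)

section Drop

variable {k : Type} [Field k] (C D : Type) [AddCommGroup C] [Module k C]
  [AddCommGroup D] [Module k D]

/-- `c ⊗ d ↦ ε(c) d`. -/
noncomputable def dropL [Coalgebra k C] : C ⊗[k] D →ₗ[k] D :=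
  (TensorProduct.lid k D).toLinearMap ∘ₗ LinearMap.rTensor D (Coalgebra.counit (R := k))

/-- `c ⊗ d ↦ ε(d) c`. -/
noncomputable def dropR [Coalgebra k D] : C ⊗[k] D →ₗ[k] C :=
  (TensorProduct.rid k C).toLinearMap ∘ₗ LinearMap.lTensor C (Coalgebra.counit (R := k))

end Drop

section Sweedler

variable {k : Type} [Field k] (H A : Type) [Ring H] [Bialgebra k H]
  [CommRing A] [Algebra k A]

variable {H A}

/-- Normalization for 1-cochains. -/
def Normalized1 (t : H →ₗ[k] A) : Prop := t 1 = 1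

/-- Normalization for 2-cochains: trivial whenever an argument is a scalar. -/
def Normalized2 (f : H ⊗[k] H →ₗ[k] A) : Prop :=
  ∀ x : H, f (1 ⊗ₜ[k] x) = algebraMap k A (Coalgebra.counit x)
    ∧ f (x ⊗ₜ[k] 1) = algebraMap k A (Coalgebra.counit x)

/-- Normalization for 3-cochains. -/
def Normalized3 (f : (H ⊗[k] H) ⊗[k] H →ₗ[k] A) : Prop :=
  ∀ x y : H,
    f ((1 ⊗ₜ[k] x) ⊗ₜ[k] y) = algebraMap k A (Coalgebra.counit x * Coalgebra.counit y)
    ∧ f ((x ⊗ₜ[k] 1) ⊗ₜ[k] y) = algebraMap k A (Coalgebra.counit x * Coalgebra.counit y)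
    ∧ f ((x ⊗ₜ[k] y) ⊗ₜ[k] 1) = algebraMap k A (Coalgebra.counit x * Coalgebra.counit y)

/-- `∑ f(x₍₁₎ ⊗ y₍₁₎) f(x₍₂₎y₍₂₎ ⊗ z)` as a linear map on `(H ⊗ H) ⊗ H`. -/
noncomputable def cocycle2LHS (f : H ⊗[k] H →ₗ[k] A) : (H ⊗[k] H) ⊗[k] H →ₗ[k] A :=
  conv (f ∘ₗ dropR (H ⊗[k] H) H) (f ∘ₗ LinearMap.rTensor H (LinearMap.mul' k H))

/-- `∑ f(y₍₁₎ ⊗ z₍₁₎) f(x ⊗ y₍₂₎z₍₂₎)` as a linear map on `(H ⊗ H) ⊗ H`. -/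
noncomputable def cocycle2RHS (f : H ⊗[k] H →ₗ[k] A) : (H ⊗[k] H) ⊗[k] H →ₗ[k] A :=
  conv (f ∘ₗ dropL H (H ⊗[k] H) ∘ₗ (TensorProduct.assoc k H H H).toLinearMap)
       (f ∘ₗ LinearMap.lTensor H (LinearMap.mul' k H) ∘ₗ (TensorProduct.assoc k H H H).toLinearMap)

/-- Sweedler 2-cocycles (for the trivial action). -/
def IsZ2 (f : H ⊗[k] H →ₗ[k] A) : Prop :=
  Normalized2 f ∧ IsConvInvertible f ∧ cocycle2LHS f = cocycle2RHS f

/-- The Sweedler 2-coboundary `∑ t(y₍₁₎) t⁻¹(x₍₁₎y₍₂₎) t(x₍₂₎)` of a 1-cochain `t`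
with convolution inverse `tinv`. -/
noncomputable def cobound2 (t tinv : H →ₗ[k] A) : H ⊗[k] H →ₗ[k] A :=
  conv (t ∘ₗ dropL H H) (conv (tinv ∘ₗ LinearMap.mul' k H) (t ∘ₗ dropR H H))

/-- Sweedler 2-coboundaries (for the trivial action). -/
def IsB2 (f : H ⊗[k] H →ₗ[k] A) : Prop :=
  ∃ t tinv : H →ₗ[k] A, Normalized1 t ∧ IsConvInv t tinv ∧ f = cobound2 t tinv

/-- Two 2-cochains are cohomologous when they differ (in convolution) by a 2-coboundary. -/
def Cohomologous2 (f f' : H ⊗[k] H →ₗ[k] A) : Prop :=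
  ∃ b, IsB2 b ∧ f = conv f' b

/-- `(x⊗y)⊗z ↦ x ⊗ yz`. -/
noncomputable def m23 : (H ⊗[k] H) ⊗[k] H →ₗ[k] H ⊗[k] H :=
  LinearMap.lTensor H (LinearMap.mul' k H) ∘ₗ (TensorProduct.assoc k H H H).toLinearMap

/-- `(x⊗y)⊗z ↦ ε(x) (y⊗z)`. -/
noncomputable def p23 : (H ⊗[k] H) ⊗[k] H →ₗ[k] H ⊗[k] H :=
  dropL H (H ⊗[k] H) ∘ₗ (TensorProduct.assoc k H H H).toLinearMap

/-- 3-cocycle condition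
`∑ f(y₁⊗z₁⊗w₁) f(x₁⊗y₂z₂⊗w₂) f(x₂⊗y₃⊗z₃) = ∑ f(x₁y₁⊗z₁⊗w₁) f(x₂⊗y₂⊗z₂w₂)`. -/
def IsZ3cond (f : (H ⊗[k] H) ⊗[k] H →ₗ[k] A) : Prop :=
  conv (f ∘ₗ LinearMap.rTensor H (LinearMap.rTensor H (dropL H H)))
    (conv (f ∘ₗ LinearMap.rTensor H (m23 (H := H)))
          (f ∘ₗ dropR ((H ⊗[k] H) ⊗[k] H) H))
  = conv (C := ((H ⊗[k] H) ⊗[k] H) ⊗[k] H)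
         (f ∘ₗ LinearMap.rTensor H (LinearMap.rTensor H (LinearMap.mul' k H)))
         (f ∘ₗ (LinearMap.lTensor (H ⊗[k] H) (LinearMap.mul' k H)
              ∘ₗ (TensorProduct.assoc k (H ⊗[k] H) H H).toLinearMap :
                ((H ⊗[k] H) ⊗[k] H) ⊗[k] H →ₗ[k] (H ⊗[k] H) ⊗[k] H))

/-- Sweedler 3-cocycles (for the trivial action). -/
def IsZ3 (f : (H ⊗[k] H) ⊗[k] H →ₗ[k] A) : Prop :=
  Normalized3 f ∧ IsConvInvertible f ∧ IsZ3cond f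

/-- The Sweedler 3-coboundary
`∑ v(y₁⊗z₁) v⁻¹(x₁y₂⊗z₂) v(x₂⊗y₃z₃) v⁻¹(x₃⊗y₄)` of a 2-cochain `v`. -/
noncomputable def cobound3 (v vinv : H ⊗[k] H →ₗ[k] A) : (H ⊗[k] H) ⊗[k] H →ₗ[k] A :=
  conv (v ∘ₗ p23 (H := H))
    (conv (vinv ∘ₗ LinearMap.rTensor H (LinearMap.mul' k H))
      (conv (v ∘ₗ m23 (H := H)) (vinv ∘ₗ dropR (H ⊗[k] H) H)))

/-- Sweedler 3-coboundaries (for the trivial action). -/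
def IsB3 (f : (H ⊗[k] H) ⊗[k] H →ₗ[k] A) : Prop :=
  ∃ v vinv : H ⊗[k] H →ₗ[k] A, Normalized2 v ∧ IsConvInv v vinv ∧ f = cobound3 v vinv

/-- Cohomologous 3-cochains. -/
def Cohomologous3 (f f' : (H ⊗[k] H) ⊗[k] H →ₗ[k] A) : Prop :=
  ∃ b, IsB3 b ∧ f = conv f' b

end Sweedler

section Measuring

variable {k : Type} [Field k]
variable {C : Type} [AddCommGroup C] [Module k C] [Coalgebra k C]
variable {N : Type} [Ring N] [Bialgebra k N]
variable {A : Type} [CommRing A] [Algebra k A]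

/-- `(C, θ)` measures `N` to `A`:
`∑ θ(c₍₁₎ ⊗ n) θ(c₍₂₎ ⊗ n') = θ(c ⊗ nn')` and `θ(c ⊗ 1) = ε(c) 1`. -/
def Measures (θ : C ⊗[k] N →ₗ[k] A) : Prop :=
  (θ ∘ₗ LinearMap.lTensor C (LinearMap.mul' k N)
    = conv (θ ∘ₗ LinearMap.lTensor C (dropR N N)) (θ ∘ₗ LinearMap.lTensor C (dropL N N)))
  ∧ ∀ c : C, θ (c ⊗ₜ[k] (1 : N)) = algebraMap k A (Coalgebra.counit c)

end Measuring

section Action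

variable {k : Type} [Field k]
variable {T N : Type} [Ring T] [Bialgebra k T] [Ring N] [Bialgebra k N]

/-- `μ : T ⊗ N → N` makes `N` a left `T`-module bialgebra. -/
structure IsModuleBialgebra (μ : T ⊗[k] N →ₗ[k] N) : Prop where
  one_act : ∀ n : N, μ ((1 : T) ⊗ₜ[k] n) = n
  mul_act : ∀ (t s : T) (n : N), μ ((t * s) ⊗ₜ[k] n) = μ (t ⊗ₜ[k] μ (s ⊗ₜ[k] n))
  act_one : ∀ t : T, μ (t ⊗ₜ[k] (1 : N)) = algebraMap k N (Coalgebra.counit t)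
  act_mul : μ ∘ₗ LinearMap.lTensor T (LinearMap.mul' k N)
      = LinearMap.mul' k N ∘ₗ TensorProduct.map μ μ
          ∘ₗ (TensorProduct.tensorTensorTensorComm k T T N N).toLinearMap
          ∘ₗ LinearMap.rTensor (N ⊗[k] N) Coalgebra.comul
  comul_act : Coalgebra.comul ∘ₗ μ
      = TensorProduct.map μ μ
          ∘ₗ (TensorProduct.tensorTensorTensorComm k T T N N).toLinearMap
          ∘ₗ TensorProduct.map Coalgebra.comul Coalgebra.comul
  counit_act : ∀ (t : T) (n : N),
      Coalgebra.counit (R := k) (μ (t ⊗ₜ[k] n))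
        = Coalgebra.counit (R := k) t * Coalgebra.counit (R := k) n

/-- `t ⊗ n ↦ ∑ t₍₁₎(n) ⊗ t₍₂₎`. -/
noncomputable def smashCross (μ : T ⊗[k] N →ₗ[k] N) : T ⊗[k] N →ₗ[k] N ⊗[k] T :=
  TensorProduct.map μ LinearMap.id
    ∘ₗ (TensorProduct.assoc k T N T).symm.toLinearMap
    ∘ₗ LinearMap.lTensor T (TensorProduct.comm k T N).toLinearMap
    ∘ₗ (TensorProduct.assoc k T T N).toLinearMap
    ∘ₗ LinearMap.rTensor N Coalgebra.comul

variable {H : Type} [Ring H] [Bialgebra k H]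

/-- `H` is the smash product `N ⋊ T` along the action `μ`, with `N` and `T` included
as the Hopf subalgebras `N ⋊ 1` and `1 ⋊ T`; we identify `n ⋊ t = n t`. -/
structure IsSmashProduct (μ : T ⊗[k] N →ₗ[k] N) (iN : N →ₐc[k] H) (iT : T →ₐc[k] H) : Prop where
  act : IsModuleBialgebra μ
  injN : Function.Injective iN
  injT : Function.Injective iT
  /-- `n ⊗ t ↦ (n ⋊ 1)(1 ⋊ t)` is a linear isomorphism `N ⊗ T ≅ H` (`H` is the
  tensor product coalgebra `N ⊗ T`). -/
  bij : Function.Bijective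
    (LinearMap.mul' k H ∘ₗ TensorProduct.map (iN : N →ₗ[k] H) (iT : T →ₗ[k] H))
  /-- The smash relation `t n = ∑ t₍₁₎(n) t₍₂₎` in `H`. -/
  straighten : LinearMap.mul' k H ∘ₗ TensorProduct.map (iT : T →ₗ[k] H) (iN : N →ₗ[k] H)
      = LinearMap.mul' k H ∘ₗ TensorProduct.map (iN : N →ₗ[k] H) (iT : T →ₗ[k] H)
          ∘ₗ smashCross μ

end Action

section MeasCohomology

variable {k : Type} [Field k]
variable {T N : Type} [Ring T] [Bialgebra k T] [Ring N] [Bialgebra k N]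
variable {A : Type} [CommRing A] [Algebra k A]

/-- Normalization in the `T`-variable for measuring 1-cochains `T ⊗ N → A`. -/
def MeasNormalized1 (f : T ⊗[k] N →ₗ[k] A) : Prop :=
  ∀ n : N, f ((1 : T) ⊗ₜ[k] n) = algebraMap k A (Coalgebra.counit n)

/-- A measuring 1-cochain: an element of `Reg_meas(T, Hom(N,A))`. -/
def IsRegMeas1 (f : T ⊗[k] N →ₗ[k] A) : Prop :=
  Measures f ∧ MeasNormalized1 f ∧ IsConvInvertible f

/-- The measuring 1-cocycle condition `f(ts)(n) = ∑ f(s₍₁₎)(n₍₁₎) f(t)(s₍₂₎(n₍₂₎))`. -/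
def MeasCocycle1 (μ : T ⊗[k] N →ₗ[k] N) (f : T ⊗[k] N →ₗ[k] A) : Prop :=
  f ∘ₗ LinearMap.rTensor N (LinearMap.mul' k T)
    = conv (f ∘ₗ LinearMap.rTensor N (dropL T T))
      (f ∘ₗ LinearMap.lTensor T μ ∘ₗ (TensorProduct.assoc k T T N).toLinearMap)

/-- Measuring 1-cocycles. -/
def IsMeasZ1 (μ : T ⊗[k] N →ₗ[k] N) (f : T ⊗[k] N →ₗ[k] A) : Prop :=
  IsRegMeas1 f ∧ MeasCocycle1 μ f

/-- Measuring 1-coboundaries: `f(t)(n) = ∑ g(n₍₁₎) g⁻¹(t(n₍₂₎))` for a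
convolution-invertible algebra map `g : N → A`. -/
def IsMeasB1 (μ : T ⊗[k] N →ₗ[k] N) (f : T ⊗[k] N →ₗ[k] A) : Prop :=
  ∃ (g : N →ₐ[k] A) (ginv : N →ₗ[k] A), IsConvInv g.toLinearMap ginv ∧
    f = conv (g.toLinearMap ∘ₗ dropL T N) (ginv ∘ₗ μ)

/-- Normalization for measuring 2-cochains `(T ⊗ T) ⊗ N → A`. -/
def MeasNormalized2 (f : (T ⊗[k] T) ⊗[k] N →ₗ[k] A) : Prop :=
  ∀ (t : T) (n : N),
    f (((1 : T) ⊗ₜ[k] t) ⊗ₜ[k] n)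
        = algebraMap k A (Coalgebra.counit t * Coalgebra.counit n)
    ∧ f ((t ⊗ₜ[k] (1 : T)) ⊗ₜ[k] n)
        = algebraMap k A (Coalgebra.counit t * Coalgebra.counit n)

/-- A measuring 2-cochain: an element of `Reg_meas(T ⊗ T, Hom(N,A))`. -/
def IsRegMeas2 (f : (T ⊗[k] T) ⊗[k] N →ₗ[k] A) : Prop :=
  Measures f ∧ MeasNormalized2 f ∧ IsConvInvertible f

/-- The measuring 2-cocycle condition
`∑ f(t₍₁₎⊗s₍₁₎)(r₍₁₎(n₍₁₎)) f(t₍₂₎s₍₂₎⊗r₍₂₎)(n₍₂₎) = ∑ f(s₍₁₎⊗r₍₁₎)(n₍₁₎) f(t⊗s₍₂₎r₍₂₎)(n₍₂₎)`. -/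
def MeasCocycle2 (μ : T ⊗[k] N →ₗ[k] N) (f : (T ⊗[k] T) ⊗[k] N →ₗ[k] A) : Prop :=
  conv (C := ((T ⊗[k] T) ⊗[k] T) ⊗[k] N)
       (f ∘ₗ (LinearMap.lTensor (T ⊗[k] T) μ
          ∘ₗ (TensorProduct.assoc k (T ⊗[k] T) T N).toLinearMap :
            ((T ⊗[k] T) ⊗[k] T) ⊗[k] N →ₗ[k] (T ⊗[k] T) ⊗[k] N))
       (f ∘ₗ LinearMap.rTensor N (LinearMap.rTensor T (LinearMap.mul' k T)))
    = conv (C := ((T ⊗[k] T) ⊗[k] T) ⊗[k] N)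
           (f ∘ₗ LinearMap.rTensor N (LinearMap.rTensor T (dropL T T)))
           (f ∘ₗ LinearMap.rTensor N
              ((LinearMap.lTensor T (LinearMap.mul' k T)
                ∘ₗ (TensorProduct.assoc k T T T).toLinearMap :
                  (T ⊗[k] T) ⊗[k] T →ₗ[k] T ⊗[k] T)))

/-- Measuring 2-cocycles. -/
def IsMeasZ2 (μ : T ⊗[k] N →ₗ[k] N) (f : (T ⊗[k] T) ⊗[k] N →ₗ[k] A) : Prop :=
  IsRegMeas2 f ∧ MeasCocycle2 μ f

/-- The measuring coboundary
`(t ⊗ s ⊗ n) ↦ ∑ g(s₍₁₎)(n₍₁₎) g⁻¹(t₍₁₎s₍₂₎)(n₍₂₎) g(t₍₂₎)(s₍₃₎(n₍₃₎))`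
of a 1-cochain `g` with convolution inverse `ginv`.  (For a 2-cocycle `f` on `N` with
stability witness `g`, this same formula is the map `d`. ) -/
noncomputable def measCobound (μ : T ⊗[k] N →ₗ[k] N) (g ginv : T ⊗[k] N →ₗ[k] A) :
    (T ⊗[k] T) ⊗[k] N →ₗ[k] A :=
  conv (g ∘ₗ LinearMap.rTensor N (dropL T T))
    (conv (ginv ∘ₗ LinearMap.rTensor N (LinearMap.mul' k T))
          (g ∘ₗ LinearMap.lTensor T μ ∘ₗ (TensorProduct.assoc k T T N).toLinearMap))

/-- Measuring 2-coboundaries. -/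
def IsMeasB2 (μ : T ⊗[k] N →ₗ[k] N) (f : (T ⊗[k] T) ⊗[k] N →ₗ[k] A) : Prop :=
  ∃ g ginv : T ⊗[k] N →ₗ[k] A, IsRegMeas1 g ∧ IsConvInv g ginv ∧ f = measCobound μ g ginv

/-- Cohomologous measuring 2-cochains. -/
def MeasCohomologous2 (μ : T ⊗[k] N →ₗ[k] N) (f f' : (T ⊗[k] T) ⊗[k] N →ₗ[k] A) : Prop :=
  ∃ b, IsMeasB2 μ b ∧ f = conv f' b

/-- `∑ f(n₍₁₎ ⊗ n'₍₁₎) f⁻¹(t₍₁₎(n₍₂₎) ⊗ t₍₂₎(n'₍₂₎))` as a map `T ⊗ (N ⊗ N) → A`. -/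
noncomputable def stabLHS (μ : T ⊗[k] N →ₗ[k] N) (f finv : N ⊗[k] N →ₗ[k] A) :
    T ⊗[k] (N ⊗[k] N) →ₗ[k] A :=
  conv (f ∘ₗ dropL T (N ⊗[k] N))
       (finv ∘ₗ TensorProduct.map μ μ
          ∘ₗ (TensorProduct.tensorTensorTensorComm k T T N N).toLinearMap
          ∘ₗ LinearMap.rTensor (N ⊗[k] N) Coalgebra.comul)

/-- `∑ g(t₍₁₎ ⊗ n₍₁₎) g⁻¹(t₍₂₎ ⊗ n₍₂₎n'₍₁₎) g(t₍₃₎ ⊗ n'₍₂₎)` as a map `T ⊗ (N ⊗ N) → A`. -/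
noncomputable def stabRHS (g ginv : T ⊗[k] N →ₗ[k] A) : T ⊗[k] (N ⊗[k] N) →ₗ[k] A :=
  conv (g ∘ₗ LinearMap.lTensor T (dropR N N))
    (conv (ginv ∘ₗ LinearMap.lTensor T (LinearMap.mul' k N))
          (g ∘ₗ LinearMap.lTensor T (dropL N N)))

/-- `g` (with convolution inverse `ginv`) witnesses the `T`-stability of the
2-cochain `f` on `N` (with convolution inverse `finv`):
`f * (f⁻¹)ᵗ = δ'(g(t ⊗ _))`. -/
def IsStabilityWitness (μ : T ⊗[k] N →ₗ[k] N) (f finv : N ⊗[k] N →ₗ[k] A)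
    (g ginv : T ⊗[k] N →ₗ[k] A) : Prop :=
  MeasNormalized1 g ∧ (∀ t : T, g (t ⊗ₜ[k] (1 : N)) = algebraMap k A (Coalgebra.counit t))
    ∧ IsConvInv g ginv ∧ stabLHS μ f finv = stabRHS g ginv

/-- The cohomology class of the 2-cocycle `f` on `N` is `T`-stable. -/
def IsTStable (μ : T ⊗[k] N →ₗ[k] N) (f finv : N ⊗[k] N →ₗ[k] A) : Prop :=
  ∃ g ginv, IsStabilityWitness μ f finv g ginv

end MeasCohomology

section SmashStatements

variable {k : Type} [Field k]
variable {T N H A : Type} [Ring T] [Bialgebra k T] [Ring N] [Bialgebra k N]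
  [Ring H] [Bialgebra k H] [CommRing A] [Algebra k A]

/-- `n ⊗ t ↦ (n ⋊ 1)(1 ⋊ t) = n ⋊ t`. -/
noncomputable def smashMul (iN : N →ₐc[k] H) (iT : T →ₐc[k] H) : N ⊗[k] T →ₗ[k] H :=
  LinearMap.mul' k H ∘ₗ TensorProduct.map iN.toLinearMap iT.toLinearMap

/-- The restriction of a 2-cochain on `H` to `N ⊗ N`. -/
noncomputable def resNN (iN : N →ₐc[k] H) (f : H ⊗[k] H →ₗ[k] A) : N ⊗[k] N →ₗ[k] A :=
  f ∘ₗ TensorProduct.map iN.toLinearMap iN.toLinearMap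

/-- The restriction of a 2-cochain on `H` to `T ⊗ T`. -/
noncomputable def resTT (iT : T →ₐc[k] H) (f : H ⊗[k] H →ₗ[k] A) : T ⊗[k] T →ₗ[k] A :=
  f ∘ₗ TensorProduct.map iT.toLinearMap iT.toLinearMap

/-- The restriction of a 2-cochain on `H` to `T ⊗ N`. -/
noncomputable def resTN (iN : N →ₐc[k] H) (iT : T →ₐc[k] H) (f : H ⊗[k] H →ₗ[k] A) :
    T ⊗[k] N →ₗ[k] A :=
  f ∘ₗ TensorProduct.map iT.toLinearMap iN.toLinearMap

/-- `f` is trivial on `N ⊗ T`: `f(n ⊗ t) = ε(n)ε(t)1`. -/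
def TrivialOnNT (iN : N →ₐc[k] H) (iT : T →ₐc[k] H) (f : H ⊗[k] H →ₗ[k] A) : Prop :=
  ∀ (n : N) (t : T), f (iN n ⊗ₜ[k] iT t)
    = algebraMap k A (Coalgebra.counit n * Coalgebra.counit t)

/-- `f` is trivial on `T ⊗ T`. -/
def TrivialOnTT (iT : T →ₐc[k] H) (f : H ⊗[k] H →ₗ[k] A) : Prop :=
  ∀ t t' : T, f (iT t ⊗ₜ[k] iT t')
    = algebraMap k A (Coalgebra.counit t * Coalgebra.counit t')

/-- `F` is the 2-cochain `ι f : (n ⋊ t) ⊗ (n' ⋊ t') ↦ ε(n) f(t)(n') ε(t')` on `H`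
associated with a measuring 1-cochain `f`. -/
def IotaOf (iN : N →ₐc[k] H) (iT : T →ₐc[k] H) (f : T ⊗[k] N →ₗ[k] A)
    (F : H ⊗[k] H →ₗ[k] A) : Prop :=
  ∀ (n : N) (t : T) (n' : N) (t' : T),
    F ((iN n * iT t) ⊗ₜ[k] (iN n' * iT t'))
      = algebraMap k A (Coalgebra.counit n * Coalgebra.counit t') * f (t ⊗ₜ[k] n')

/-- `J` is the 3-cochain
`jf : (n⋊t) ⊗ (n'⋊t') ⊗ (n''⋊t'') ↦ ε(n)ε(n') f(t⊗t')(n'') ε(t'')` on `H`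
associated with a measuring 2-cochain `f`. -/
def JOf (iN : N →ₐc[k] H) (iT : T →ₐc[k] H) (f : (T ⊗[k] T) ⊗[k] N →ₗ[k] A)
    (J : (H ⊗[k] H) ⊗[k] H →ₗ[k] A) : Prop :=
  ∀ (n : N) (t : T) (n' : N) (t' : T) (n'' : N) (t'' : T),
    J (((iN n * iT t) ⊗ₜ[k] (iN n' * iT t')) ⊗ₜ[k] (iN n'' * iT t''))
      = algebraMap k A (Coalgebra.counit n * Coalgebra.counit n' * Coalgebra.counit t'')
          * f ((t ⊗ₜ[k] t') ⊗ₜ[k] n'')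

end SmashStatements

end SmashPaper

open TensorProduct SmashPaper

namespace SmashPaper

open WithConv

section Pullback

variable {k : Type} [Field k] {A : Type} [CommRing A] [Algebra k A]
  {C D E : Type} [AddCommGroup C] [Module k C] [Coalgebra k C]
  [AddCommGroup D] [Module k D] [Coalgebra k D] [AddCommGroup E] [Module k E] [Coalgebra k E]

/-- Precomposition with a coalgebra morphism, as a morphism of convolution monoids. -/
def pull (φ : C →ₗc[k] D) : WithConv (D →ₗ[k] A) →* WithConv (C →ₗ[k] A) where
  toFun f := toConv (f.ofConv ∘ₗ φ.toLinearMap)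
  map_one' := by
    ext x
    simp [LinearMap.convOne_def]
  map_mul' f g := by
    have := LinearMap.convMul_comp_coalgHom_distrib f g φ
    exact congrArg toConv this

theorem pull_apply (φ : C →ₗc[k] D) (f : WithConv (D →ₗ[k] A)) (x : C) :
    (pull φ f).ofConv x = f.ofConv (φ x) := rfl

theorem pull_pull (φ : C →ₗc[k] D) (ψ : D →ₗc[k] E) (f : WithConv (E →ₗ[k] A)) :
    pull φ (pull ψ f) = pull (ψ.comp φ) f := rfl

theorem pull_id (f : WithConv (C →ₗ[k] A)) : pull (CoalgHom.id k C) f = f := rfl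

theorem toConv_conv (f g : C →ₗ[k] A) : toConv (conv f g) = toConv f * toConv g := rfl

theorem isConvInv_iff (f g : C →ₗ[k] A) :
    IsConvInv f g ↔ toConv f * toConv g = 1 ∧ toConv g * toConv f = 1 := by
  rw [← toConv_conv, ← toConv_conv, LinearMap.convOne_def, toConv_injective.eq_iff,
    toConv_injective.eq_iff]
  rfl

theorem isConvInvertible_iff (f : C →ₗ[k] A) : IsConvInvertible f ↔ IsUnit (toConv f) := by
  rw [isUnit_iff_exists]
  constructor
  · rintro ⟨g, hg⟩
    exact ⟨toConv g, (isConvInv_iff f g).1 hg⟩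
  · rintro ⟨g, hg⟩
    exact ⟨g.ofConv, (isConvInv_iff f g.ofConv).2 hg⟩

variable (k C D) in
/-- `dropL` as a coalgebra morphism. -/
noncomputable def dropLHom : C ⊗[k] D →ₗc[k] D :=
  (Coalgebra.TensorProduct.lid k D).toCoalgHom.comp
    (Coalgebra.TensorProduct.map (Coalgebra.counitCoalgHom k C) (CoalgHom.id k D))

variable (k C D) in
/-- `dropR` as a coalgebra morphism. -/
noncomputable def dropRHom : C ⊗[k] D →ₗc[k] C :=
  (Coalgebra.TensorProduct.rid k k C).toCoalgHom.comp
    (Coalgebra.TensorProduct.map (CoalgHom.id k C) (Coalgebra.counitCoalgHom k D))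

@[simp]
theorem dropLHom_tmul (c : C) (d : D) :
    dropLHom k C D (c ⊗ₜ d) = Coalgebra.counit (R := k) c • d := rfl

@[simp]
theorem dropRHom_tmul (c : C) (d : D) :
    dropRHom k C D (c ⊗ₜ d) = Coalgebra.counit (R := k) d • c := rfl

theorem coalgHom_ext_tmul {φ ψ : C ⊗[k] D →ₗc[k] E}
    (h : ∀ c d, φ (c ⊗ₜ d) = ψ (c ⊗ₜ d)) : φ = ψ :=
  CoalgHom.coe_linearMap_injective (TensorProduct.ext' h)

theorem coalgHom_ext_tmul_tmul {F : Type} [AddCommGroup F] [Module k F] [Coalgebra k F]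
    {φ ψ : (C ⊗[k] D) ⊗[k] E →ₗc[k] F}
    (h : ∀ c d e, φ ((c ⊗ₜ d) ⊗ₜ e) = ψ ((c ⊗ₜ d) ⊗ₜ e)) : φ = ψ :=
  CoalgHom.coe_linearMap_injective (TensorProduct.ext_threefold h)

end Pullback

section Bialgebra

variable {k : Type} [Field k] {A : Type} [CommRing A] [Algebra k A]
  {C D : Type} [Ring C] [Bialgebra k C] [Ring D] [Bialgebra k D]

variable (k C) in
/-- The unit of a bialgebra as a coalgebra morphism. -/
noncomputable def unitHom : k →ₗc[k] C where
  toLinearMap := Algebra.linearMap k C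
  counit_comp := by ext; simp
  map_comp_comul := by ext; simp [Algebra.TensorProduct.one_def]

@[simp]
theorem unitHom_apply (r : k) : unitHom k C r = algebraMap k C r := rfl

theorem normalized1_iff (t : C →ₗ[k] A) :
    Normalized1 t ↔ pull (unitHom k C) (toConv t) = 1 := by
  constructor
  · intro h
    have h1 : t 1 = 1 := h
    ext
    simp [pull, h1]
  · intro h
    have := congrArg (fun F => F.ofConv 1) h
    simpa [pull, LinearMap.convOne_def, Normalized1] using this

variable (k C D) in
/-- `d ↦ 1 ⊗ d` as a coalgebra morphism. -/
noncomputable def inclR : D →ₗc[k] C ⊗[k] D :=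
  (Coalgebra.TensorProduct.map (unitHom k C) (CoalgHom.id k D)).comp
    (Coalgebra.TensorProduct.lid k D).symm.toCoalgHom

variable (k C D) in
/-- `c ↦ c ⊗ 1` as a coalgebra morphism. -/
noncomputable def inclL : C →ₗc[k] C ⊗[k] D :=
  (Coalgebra.TensorProduct.map (CoalgHom.id k C) (unitHom k D)).comp
    (Coalgebra.TensorProduct.rid k k C).symm.toCoalgHom

@[simp]
theorem inclR_apply (d : D) : inclR k C D d = 1 ⊗ₜ d := by
  change (algebraMap k C 1) ⊗ₜ[k] d = 1 ⊗ₜ d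
  rw [map_one]

@[simp]
theorem inclL_apply (c : C) : inclL k C D c = c ⊗ₜ 1 := by
  change c ⊗ₜ[k] (algebraMap k D 1) = c ⊗ₜ 1
  rw [map_one]

theorem dropLHom_comp_inclR : (dropLHom k C D).comp (inclR k C D) = CoalgHom.id k D := by
  ext x; simp

theorem dropRHom_comp_inclL : (dropRHom k C D).comp (inclL k C D) = CoalgHom.id k C := by
  ext x; simp

theorem dropRHom_comp_inclR :
    (dropRHom k C D).comp (inclR k C D) = (unitHom k C).comp (Coalgebra.counitCoalgHom k D) := by
  ext x; simp [Algebra.algebraMap_eq_smul_one]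

theorem dropLHom_comp_inclL :
    (dropLHom k C D).comp (inclL k C D) = (unitHom k D).comp (Coalgebra.counitCoalgHom k C) := by
  ext x; simp [Algebra.algebraMap_eq_smul_one]

theorem mulCoalgHom_comp_inclR :
    (Bialgebra.mulCoalgHom k C).comp (inclR k C C) = CoalgHom.id k C := by
  ext x; simp

theorem mulCoalgHom_comp_inclL :
    (Bialgebra.mulCoalgHom k C).comp (inclL k C C) = CoalgHom.id k C := by
  ext x; simp

theorem normalized2_iff (f : C ⊗[k] C →ₗ[k] A) :
    Normalized2 f ↔ pull (inclR k C C) (toConv f) = 1 ∧ pull (inclL k C C) (toConv f) = 1 := by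
  constructor
  · intro h
    constructor
    · ext x
      simpa [pull, LinearMap.convOne_def] using (h x).1
    · ext x
      simpa [pull, LinearMap.convOne_def] using (h x).2
  · rintro ⟨h₁, h₂⟩ x
    have h₁ := congrArg (fun F => F.ofConv x) h₁
    have h₂ := congrArg (fun F => F.ofConv x) h₂
    simp only [pull_apply, inclR_apply, inclL_apply] at h₁ h₂
    exact ⟨h₁, h₂⟩

variable (k C) in
/-- `m23` as a coalgebra morphism. -/
noncomputable def m23Hom : (C ⊗[k] C) ⊗[k] C →ₗc[k] C ⊗[k] C :=
  (Coalgebra.TensorProduct.map (CoalgHom.id k C) (Bialgebra.mulCoalgHom k C)).comp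
    (Coalgebra.TensorProduct.assoc k k C C C).toCoalgHom

variable (k C) in
/-- `p23` as a coalgebra morphism. -/
noncomputable def p23Hom : (C ⊗[k] C) ⊗[k] C →ₗc[k] C ⊗[k] C :=
  (dropLHom k C (C ⊗[k] C)).comp (Coalgebra.TensorProduct.assoc k k C C C).toCoalgHom

variable (k C) in
/-- `(x ⊗ y) ⊗ z ↦ xy ⊗ z` as a coalgebra morphism. -/
noncomputable def m12Hom : (C ⊗[k] C) ⊗[k] C →ₗc[k] C ⊗[k] C :=
  Coalgebra.TensorProduct.map (Bialgebra.mulCoalgHom k C) (CoalgHom.id k C)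

@[simp]
theorem m23Hom_tmul (x y z : C) : m23Hom k C ((x ⊗ₜ y) ⊗ₜ z) = x ⊗ₜ (y * z) := rfl

@[simp]
theorem p23Hom_tmul (x y z : C) :
    p23Hom k C ((x ⊗ₜ y) ⊗ₜ z) = Coalgebra.counit (R := k) x • (y ⊗ₜ z) := rfl

@[simp]
theorem m12Hom_tmul (x y z : C) : m12Hom k C ((x ⊗ₜ y) ⊗ₜ z) = (x * y) ⊗ₜ z := rfl

theorem cocycle2LHS_eq (f : C ⊗[k] C →ₗ[k] A) :
    toConv (cocycle2LHS f) =
      pull (dropRHom k (C ⊗[k] C) C) (toConv f) * pull (m12Hom k C) (toConv f) := rfl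

theorem cocycle2RHS_eq (f : C ⊗[k] C →ₗ[k] A) :
    toConv (cocycle2RHS f) = pull (p23Hom k C) (toConv f) * pull (m23Hom k C) (toConv f) := rfl

theorem cobound2_eq (t tinv : C →ₗ[k] A) :
    toConv (cobound2 t tinv) = pull (dropLHom k C C) (toConv t) *
      (pull (Bialgebra.mulCoalgHom k C) (toConv tinv) * pull (dropRHom k C C) (toConv t)) := rfl

theorem isZ2_iff (f : C ⊗[k] C →ₗ[k] A) :
    IsZ2 f ↔ (pull (inclR k C C) (toConv f) = 1 ∧ pull (inclL k C C) (toConv f) = 1) ∧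
      IsUnit (toConv f) ∧
      pull (dropRHom k (C ⊗[k] C) C) (toConv f) * pull (m12Hom k C) (toConv f) =
        pull (p23Hom k C) (toConv f) * pull (m23Hom k C) (toConv f) := by
  rw [IsZ2, normalized2_iff, isConvInvertible_iff, ← cocycle2LHS_eq, ← cocycle2RHS_eq,
    toConv_injective.eq_iff (a := cocycle2LHS f)]

theorem IsZ2.conv [Coalgebra.IsCocomm k C] {f g : C ⊗[k] C →ₗ[k] A} (hf : IsZ2 f) (hg : IsZ2 g) :
    IsZ2 (conv f g) := by
  rw [isZ2_iff] at hf hg ⊢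
  obtain ⟨⟨hf₁, hf₂⟩, hf₃, hf₄⟩ := hf
  obtain ⟨⟨hg₁, hg₂⟩, hg₃, hg₄⟩ := hg
  simp only [toConv_conv, map_mul]
  refine ⟨⟨by rw [hf₁, hg₁, one_mul], by rw [hf₂, hg₂, one_mul]⟩, hf₃.mul hg₃, ?_⟩
  rw [mul_mul_mul_comm, hf₄, hg₄, mul_mul_mul_comm]

theorem cobound2_mul_cobound2_swap [Coalgebra.IsCocomm k C] {t tinv : C →ₗ[k] A}
    (h : IsConvInv t tinv) : toConv (cobound2 t tinv) * toConv (cobound2 tinv t) = 1 := by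
  have h := ((isConvInv_iff t tinv).1 h).1
  have hL := congrArg (pull (dropLHom k C C)) h
  have hM := congrArg (pull (Bialgebra.mulCoalgHom k C)) h
  have hR := congrArg (pull (dropRHom k C C)) h
  simp only [map_mul, map_one] at hL hM hR
  rw [cobound2_eq, cobound2_eq, mul_mul_mul_comm, mul_mul_mul_comm (pull _ (toConv tinv)),
    hL, hR, mul_comm (pull _ (toConv tinv)), hM, one_mul, one_mul]

theorem IsConvInv.symm {t tinv : C →ₗ[k] A} (h : IsConvInv t tinv) : IsConvInv tinv t :=
  ⟨h.2, h.1⟩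

theorem Normalized1.of_isConvInv {t tinv : C →ₗ[k] A} (ht : Normalized1 t)
    (h : IsConvInv t tinv) : Normalized1 tinv := by
  rw [normalized1_iff] at ht ⊢
  have h := congrArg (pull (unitHom k C)) ((isConvInv_iff t tinv).1 h).1
  rwa [map_mul, ht, one_mul, map_one] at h

theorem isZ2_cobound2 [Coalgebra.IsCocomm k C] {t tinv : C →ₗ[k] A} (ht : Normalized1 t)
    (h : IsConvInv t tinv) : IsZ2 (cobound2 t tinv) := by
  have hu := cobound2_mul_cobound2_swap h
  have hM := ((isConvInv_iff t tinv).1 h).1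
  rw [normalized1_iff] at ht
  rw [isZ2_iff]
  refine ⟨⟨?_, ?_⟩, IsUnit.of_mul_eq_one _ hu, ?_⟩
  · simp only [cobound2_eq, map_mul, pull_pull, dropLHom_comp_inclR, mulCoalgHom_comp_inclR,
      dropRHom_comp_inclR, pull_id]
    rw [← pull_pull, ht, map_one, mul_one, hM]
  · simp only [cobound2_eq, map_mul, pull_pull, dropLHom_comp_inclL, mulCoalgHom_comp_inclL,
      dropRHom_comp_inclL, pull_id]
    rw [← pull_pull, ht, map_one, one_mul, mul_comm, hM]
  · have e₁ : (dropLHom k C C).comp (m12Hom k C) = (dropLHom k C C).comp (p23Hom k C) :=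
      coalgHom_ext_tmul_tmul fun x y z => by simp [mul_smul]
    have e₂ : (dropLHom k C C).comp (dropRHom k (C ⊗[k] C) C) =
        (dropRHom k C C).comp (p23Hom k C) :=
      coalgHom_ext_tmul_tmul fun x y z => by simp [smul_smul, mul_comm]
    have e₃ : (dropRHom k C C).comp (dropRHom k (C ⊗[k] C) C) =
        (dropRHom k C C).comp (m23Hom k C) :=
      coalgHom_ext_tmul_tmul fun x y z => by simp [smul_smul, mul_comm]
    have e₄ : (Bialgebra.mulCoalgHom k C).comp (m12Hom k C) =
        (Bialgebra.mulCoalgHom k C).comp (m23Hom k C) :=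
      coalgHom_ext_tmul_tmul fun x y z => by simp [mul_assoc]
    have e₅ : (Bialgebra.mulCoalgHom k C).comp (dropRHom k (C ⊗[k] C) C) =
        (dropRHom k C C).comp (m12Hom k C) :=
      coalgHom_ext_tmul_tmul fun x y z => by simp
    have e₆ : (Bialgebra.mulCoalgHom k C).comp (p23Hom k C) =
        (dropLHom k C C).comp (m23Hom k C) :=
      coalgHom_ext_tmul_tmul fun x y z => by simp
    have h₁ := congrArg (pull ((dropRHom k C C).comp (m12Hom k C))) hM
    have h₂ := congrArg (pull ((dropLHom k C C).comp (m23Hom k C))) hM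
    simp only [cobound2_eq, map_mul, map_one, pull_pull, e₁, e₂, e₃, e₄, e₅, e₆] at h₁ h₂ ⊢
    linear_combination
      pull ((dropLHom k C C).comp (p23Hom k C)) (toConv t) *
        pull ((dropRHom k C C).comp (p23Hom k C)) (toConv t) *
        pull ((dropRHom k C C).comp (m23Hom k C)) (toConv t) *
        pull ((Bialgebra.mulCoalgHom k C).comp (m23Hom k C)) (toConv tinv) * (h₁ - h₂)

end Bialgebra

section Smash

variable {k : Type} [Field k] {T N H A : Type} [Ring T] [Bialgebra k T] [Ring N] [Bialgebra k N]
  [Ring H] [Bialgebra k H] [CommRing A] [Algebra k A]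

theorem IsCocomm.isCocomm {C : Type} [AddCommGroup C] [Module k C] [Coalgebra k C]
    (h : IsCocomm k C) : Coalgebra.IsCocomm k C := ⟨h⟩

theorem isCocomm_of_coalgEquiv {C D : Type} [AddCommGroup C] [Module k C] [Coalgebra k C]
    [AddCommGroup D] [Module k D] [Coalgebra k D] [Coalgebra.IsCocomm k C] (e : C ≃ₗc[k] D) :
    Coalgebra.IsCocomm k D where
  comm_comp_comul := by
    ext x
    obtain ⟨y, rfl⟩ : ∃ y, e y = x := ⟨e.symm x, e.apply_symm_apply x⟩
    have h : ∀ z : C, Coalgebra.comul (R := k) (e z) =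
        TensorProduct.map e.toCoalgHom.toLinearMap e.toCoalgHom.toLinearMap
          (Coalgebra.comul (R := k) z) :=
      fun z => (CoalgHomClass.map_comp_comul_apply e z).symm
    simp only [LinearMap.comp_apply, LinearEquiv.coe_coe, h]
    rw [← TensorProduct.map_comm, Coalgebra.comm_comul]

@[simp]
theorem toCoalgHom_apply (φ : T →ₐc[k] H) (t : T) : φ.toCoalgHom t = φ t := rfl

/-- The coalgebra morphism `φ ⊗ ψ` induced by two bialgebra morphisms into `H`. -/
noncomputable def tensorHom (φ : N →ₐc[k] H) (ψ : T →ₐc[k] H) : N ⊗[k] T →ₗc[k] H ⊗[k] H :=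
  Coalgebra.TensorProduct.map φ.toCoalgHom ψ.toCoalgHom

@[simp]
theorem tensorHom_tmul (φ : N →ₐc[k] H) (ψ : T →ₐc[k] H) (n : N) (t : T) :
    tensorHom φ ψ (n ⊗ₜ t) = φ n ⊗ₜ ψ t := rfl

theorem dropLHom_comp_tensorHom (φ : N →ₐc[k] H) (ψ : T →ₐc[k] H) :
    (dropLHom k H H).comp (tensorHom φ ψ) = ψ.toCoalgHom.comp (dropLHom k N T) :=
  coalgHom_ext_tmul fun n t => by simp

theorem dropRHom_comp_tensorHom (φ : N →ₐc[k] H) (ψ : T →ₐc[k] H) :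
    (dropRHom k H H).comp (tensorHom φ ψ) = φ.toCoalgHom.comp (dropRHom k N T) :=
  coalgHom_ext_tmul fun n t => by simp

theorem mulCoalgHom_comp_tensorHom (φ : T →ₐc[k] H) :
    (Bialgebra.mulCoalgHom k H).comp (tensorHom φ φ) =
      φ.toCoalgHom.comp (Bialgebra.mulCoalgHom k T) :=
  coalgHom_ext_tmul fun n t => by simp

theorem tensorHom_comp_inclR (φ : N →ₐc[k] H) (ψ : T →ₐc[k] H) :
    (tensorHom φ ψ).comp (inclR k N T) = (inclR k H H).comp ψ.toCoalgHom := by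
  ext x; simp

theorem tensorHom_comp_inclL (φ : N →ₐc[k] H) (ψ : T →ₐc[k] H) :
    (tensorHom φ ψ).comp (inclL k N T) = (inclL k H H).comp φ.toCoalgHom := by
  ext x; simp

theorem pull_tensorHom_eq_one_iff (φ : N →ₐc[k] H) (ψ : T →ₐc[k] H) (f : H ⊗[k] H →ₗ[k] A) :
    pull (tensorHom φ ψ) (toConv f) = 1 ↔ ∀ n t, f (φ n ⊗ₜ[k] ψ t)
      = algebraMap k A (Coalgebra.counit n * Coalgebra.counit t) := by
  constructor
  · intro h n t
    have h := congrArg (fun F => F.ofConv (n ⊗ₜ[k] t)) h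
    simpa [pull_apply, LinearMap.convOne_def, mul_comm] using h
  · intro h
    apply ofConv_injective
    refine TensorProduct.ext' fun n t => ?_
    simpa [pull_apply, LinearMap.convOne_def, mul_comm] using h n t

theorem trivialOnNT_iff (iN : N →ₐc[k] H) (iT : T →ₐc[k] H) (f : H ⊗[k] H →ₗ[k] A) :
    TrivialOnNT iN iT f ↔ pull (tensorHom iN iT) (toConv f) = 1 :=
  (pull_tensorHom_eq_one_iff iN iT f).symm

theorem trivialOnTT_iff (iT : T →ₐc[k] H) (f : H ⊗[k] H →ₗ[k] A) :
    TrivialOnTT iT f ↔ pull (tensorHom iT iT) (toConv f) = 1 :=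
  (pull_tensorHom_eq_one_iff iT iT f).symm

theorem toConv_resTT (iT : T →ₐc[k] H) (f : H ⊗[k] H →ₗ[k] A) :
    toConv (resTT iT f) = pull (tensorHom iT iT) (toConv f) := rfl

theorem pull_tensorHom_cobound2 (iT : T →ₐc[k] H) (u uinv : H →ₗ[k] A) :
    pull (tensorHom iT iT) (toConv (cobound2 u uinv)) =
      toConv (cobound2 (pull iT.toCoalgHom (toConv u)).ofConv
        (pull iT.toCoalgHom (toConv uinv)).ofConv) := by
  simp only [cobound2_eq, map_mul, pull_pull, dropLHom_comp_tensorHom,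
    dropRHom_comp_tensorHom, mulCoalgHom_comp_tensorHom, toConv_ofConv]

theorem isB2_of_toConv_eq_one {f : T ⊗[k] T →ₗ[k] A} (hf : toConv f = 1) : IsB2 f := by
  refine ⟨(1 : WithConv (T →ₗ[k] A)).ofConv, (1 : WithConv (T →ₗ[k] A)).ofConv, ?_, ?_, ?_⟩
  · simp [normalized1_iff]
  · simp [isConvInv_iff]
  · apply toConv_injective
    simp [cobound2_eq, hf]

/-- The coalgebra isomorphism `N ⊗ T ≃ H`, `n ⊗ t ↦ n ⋊ t`. -/
noncomputable def IsSmashProduct.equiv {μ : T ⊗[k] N →ₗ[k] N} {iN : N →ₐc[k] H} {iT : T →ₐc[k] H}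
    (h : IsSmashProduct μ iN iT) : N ⊗[k] T ≃ₗc[k] H :=
  CoalgEquiv.ofBijective (f := (Bialgebra.mulCoalgHom k H).comp (tensorHom iN iT)) h.bij

theorem IsSmashProduct.pull_symm {μ : T ⊗[k] N →ₗ[k] N} {iN : N →ₐc[k] H} {iT : T →ₐc[k] H}
    (h : IsSmashProduct μ iN iT) (f : WithConv (N ⊗[k] T →ₗ[k] A)) :
    pull ((Bialgebra.mulCoalgHom k H).comp (tensorHom iN iT))
      (pull h.equiv.symm.toCoalgHom f) = f := by
  apply ofConv_injective
  ext1
  ext n t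
  exact congrArg f.ofConv (h.equiv.symm_apply_apply (n ⊗ₜ t))

theorem mulCoalgHom_comp_tensorHom_comp_inclR (iN : N →ₐc[k] H) (iT : T →ₐc[k] H) :
    ((Bialgebra.mulCoalgHom k H).comp (tensorHom iN iT)).comp (inclR k N T) = iT.toCoalgHom := by
  ext x; simp

theorem mulCoalgHom_comp_tensorHom_comp_inclL (iN : N →ₐc[k] H) (iT : T →ₐc[k] H) :
    ((Bialgebra.mulCoalgHom k H).comp (tensorHom iN iT)).comp (inclL k N T) = iN.toCoalgHom := by
  ext x; simp

/-- A 2-cochain on `H = N ⋊ T` whose restriction to `T` is the coboundary of `t` becomes trivial on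
`N ⊗ T` and on `T ⊗ T` after multiplication by the coboundary of `n ⋊ s ↦ f(n ⊗ s₁) t⁻¹(s₂)`. -/
theorem IsSmashProduct.exists_cobound2_trivial {μ : T ⊗[k] N →ₗ[k] N} {iN : N →ₐc[k] H}
    {iT : T →ₐc[k] H} (h : IsSmashProduct μ iN iT) [Coalgebra.IsCocomm k T]
    [Coalgebra.IsCocomm k N] {f : H ⊗[k] H →ₗ[k] A}
    (hf : Normalized2 f) (hfu : IsConvInvertible f) (hfT : IsB2 (resTT iT f)) :
    ∃ u uinv : H →ₗ[k] A, Normalized1 u ∧ IsConvInv u uinv ∧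
      TrivialOnNT iN iT (conv f (cobound2 u uinv)) ∧
      TrivialOnTT iT (conv f (cobound2 u uinv)) := by
  obtain ⟨t, tinv, ht, hti, hft⟩ := hfT
  obtain ⟨finv, hfi⟩ := hfu
  obtain ⟨hfR, hfL⟩ := (normalized2_iff f).1 hf
  have hfi := ((isConvInv_iff f finv).1 hfi).1
  have hfiR := congrArg (pull (inclR k H H)) hfi
  rw [map_mul, hfR, one_mul, map_one] at hfiR
  have htn := (normalized1_iff tinv).1 (ht.of_isConvInv hti)
  have htt := ((isConvInv_iff t tinv).1 hti).1
  have hfi' := congrArg (pull (tensorHom iN iT)) hfi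
  have htt' := congrArg (pull (dropLHom k N T)) htt
  rw [map_mul, map_one] at hfi' htt'
  set v := pull (tensorHom iN iT) (toConv f) * pull (dropLHom k N T) (toConv tinv) with hv
  set vinv := pull (tensorHom iN iT) (toConv finv) * pull (dropLHom k N T) (toConv t) with hvinv
  have hvv : v * vinv = 1 := by
    rw [hv, hvinv, mul_mul_mul_comm, hfi', mul_comm (pull _ (toConv tinv)), htt', one_mul]
  set u := pull h.equiv.symm.toCoalgHom v with hu
  set uinv := pull h.equiv.symm.toCoalgHom vinv with huinv
  have huT : pull iT.toCoalgHom u = toConv tinv := by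
    rw [← mulCoalgHom_comp_tensorHom_comp_inclR iN iT, ← pull_pull, h.pull_symm, hv, map_mul,
      pull_pull, pull_pull, tensorHom_comp_inclR, dropLHom_comp_inclR, ← pull_pull, hfR, map_one,
      one_mul, pull_id]
  have huinvT : pull iT.toCoalgHom uinv = toConv t := by
    rw [← mulCoalgHom_comp_tensorHom_comp_inclR iN iT, ← pull_pull, h.pull_symm, hvinv, map_mul,
      pull_pull, pull_pull, tensorHom_comp_inclR, dropLHom_comp_inclR, ← pull_pull, hfiR, map_one,
      one_mul, pull_id]
  have huN : pull iN.toCoalgHom u = 1 := by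
    rw [← mulCoalgHom_comp_tensorHom_comp_inclL iN iT, ← pull_pull, h.pull_symm, hv, map_mul,
      pull_pull, pull_pull, tensorHom_comp_inclL, dropLHom_comp_inclL, ← pull_pull, hfL, map_one,
      one_mul, ← pull_pull, htn, map_one]
  have hiu : iT.toCoalgHom.comp (unitHom k T) = unitHom k H := by
    ext; simp
  refine ⟨u.ofConv, uinv.ofConv, ?_, ?_, ?_, ?_⟩
  · rw [normalized1_iff, toConv_ofConv, ← hiu, ← pull_pull, huT, htn]
  · rw [isConvInv_iff]
    constructor
    · rw [toConv_ofConv, toConv_ofConv, hu, huinv, ← map_mul, hvv, map_one]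
    · rw [toConv_ofConv, toConv_ofConv, hu, huinv, ← map_mul, mul_comm, hvv, map_one]
  · rw [trivialOnNT_iff, toConv_conv, cobound2_eq]
    simp only [map_mul, pull_pull, dropLHom_comp_tensorHom, dropRHom_comp_tensorHom,
      toConv_ofConv]
    rw [h.pull_symm, ← pull_pull _ iT.toCoalgHom, ← pull_pull _ iN.toCoalgHom, huT, huN, map_one,
      mul_one, ← mul_assoc, ← hv, hvv]
  · rw [trivialOnTT_iff, toConv_conv, map_mul, pull_tensorHom_cobound2, ← toConv_resTT, hft,
      toConv_ofConv, toConv_ofConv, huT, huinvT, ofConv_toConv, ofConv_toConv,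
      cobound2_mul_cobound2_swap hti]

end Smash

end SmashPaper


/-- **Proposition (`H'²(H,A) ≅ H̃²(H,A)`).**
Let `H = N ⋊ T` (cocommutative Hopf algebras over `k`) act trivially on the commutative
`k`-algebra `A`.  Let `Z'²(H,A)` be the group of Sweedler 2-cocycles on `H` that are
trivial on `N ⊗ T` and on `T ⊗ T`, and `B'² = B² ∩ Z'²`.  Then the natural map
`H'²(H,A) = Z'²/B'² → H²(H,A)` is injective with image `H̃²(H,A)` (the kernel of the
restriction to `T`), stated elementwise:
* every `f ∈ Z'²` restricts to a coboundary on `T ⊗ T` (so its class lies in `H̃²`);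
* if two elements of `Z'²` are cohomologous in `H²(H,A)`, they differ by an element
  of `B'²` (injectivity);
* every 2-cocycle on `H` whose restriction to `T ⊗ T` is a coboundary is cohomologous
  to an element of `Z'²` (surjectivity onto `H̃²`). -/
theorem primedH2_iso_tildeH2
    {k : Type} [Field k] {T N H A : Type}
    [Ring T] [HopfAlgebra k T] [Ring N] [HopfAlgebra k N]
    [Ring H] [HopfAlgebra k H] [CommRing A] [Algebra k A]
    (hTcc : IsCocomm k T) (hNcc : IsCocomm k N)
    (μ : T ⊗[k] N →ₗ[k] N) (iN : N →ₐc[k] H) (iT : T →ₐc[k] H)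
    (hsmash : IsSmashProduct μ iN iT) :
    (∀ f : H ⊗[k] H →ₗ[k] A,
      IsZ2 f → TrivialOnNT iN iT f → TrivialOnTT iT f →
        IsB2 (resTT iT f))
    ∧ (∀ f g : H ⊗[k] H →ₗ[k] A,
        IsZ2 f → TrivialOnNT iN iT f → TrivialOnTT iT f →
        IsZ2 g → TrivialOnNT iN iT g → TrivialOnTT iT g →
        Cohomologous2 f g →
        ∃ b : H ⊗[k] H →ₗ[k] A,
          IsB2 b ∧ TrivialOnNT iN iT b ∧ TrivialOnTT iT b ∧ f = conv g b)
    ∧ (∀ f : H ⊗[k] H →ₗ[k] A,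
        IsZ2 f → IsB2 (resTT iT f) →
        ∃ f' : H ⊗[k] H →ₗ[k] A,
          IsZ2 f' ∧ TrivialOnNT iN iT f' ∧ TrivialOnTT iT f'
            ∧ Cohomologous2 f f') := by
  have := hTcc.isCocomm
  have := hNcc.isCocomm
  have := isCocomm_of_coalgEquiv hsmash.equiv
  refine ⟨fun f _ _ hT => ?_, fun f g _ hfN hfT _ hgN hgT hfg => ?_, fun f hf hfT => ?_⟩
  · exact isB2_of_toConv_eq_one ((trivialOnTT_iff iT f).1 hT)
  · obtain ⟨b, hb, rfl⟩ := hfg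
    rw [trivialOnNT_iff] at hfN hgN
    rw [trivialOnTT_iff] at hfT hgT
    rw [toConv_conv, map_mul, hgN, one_mul] at hfN
    rw [toConv_conv, map_mul, hgT, one_mul] at hfT
    exact ⟨b, hb, (trivialOnNT_iff iN iT b).2 hfN, (trivialOnTT_iff iT b).2 hfT, rfl⟩
  · obtain ⟨u, uinv, hu, huu, hN, hT⟩ := hsmash.exists_cobound2_trivial hf.1 hf.2.1 hfT
    refine ⟨conv f (cobound2 u uinv), hf.conv (isZ2_cobound2 hu huu), hN, hT,
      cobound2 uinv u, ⟨uinv, u, hu.of_isConvInv huu, huu.symm, rfl⟩, ?_⟩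
    apply WithConv.toConv_injective
    rw [toConv_conv, toConv_conv, mul_assoc, cobound2_mul_cobound2_swap huu, mul_one]
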